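/- (Expansion of the generalized q-shifted factorial, Corollary 5.3 of the paper) For every composition u ∈ ℕ^n, (a)_u = Σ_v τ_v a^{|v|} [u; v], as a polynomial identity in the indeterminate a over ℚ(q, t), where the sum is over all compositions v ∈ ℕ^n (finitely supported on |v| ≤ |u|). -/

import Mathlib

open scoped BigOperators
open MvPolynomial

noncomputable section
namespace LRW

variable {n : ℕ}

/-- `|u|`, the weight of a composition `u ∈ ℕⁿ`. -/
def wt (u : Fin n → ℕ) : ℕ := ∑ i, u i

/-- `l'_u(i) = #{k > i : u_k > u_i} + #{k < i : u_k ≥ u_i}`. -/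
def lp (u : Fin n → ℕ) (i : Fin n) : ℕ :=
  (Finset.univ.filter fun k => i < k ∧ u i < u k).card +
  (Finset.univ.filter fun k => k < i ∧ u i ≤ u k).card

/-- The spectral vector `⟨u⟩ : ⟨u⟩_i = q^{u_i} t^{n−1−l'_u(i)}`. -/
def spec (q t : ℂ) (u : Fin n → ℕ) : Fin n → ℂ :=
  fun i => q ^ u i * t ^ (n - 1 - lp u i)

/-- Leg length `l(s)` of the cell `s = (i, j+1)` of `u` (so `j` ranges over
`0, …, u_i − 1`): `l(s) = #{k > i : j+1 ≤ u_k ≤ u_i} + #{k < i : j+1 ≤ u_k + 1 ≤ u_i}`. -/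
def leg (u : Fin n → ℕ) (i : Fin n) (j : ℕ) : ℕ :=
  (Finset.univ.filter fun k => i < k ∧ j < u k ∧ u k ≤ u i).card +
  (Finset.univ.filter fun k => k < i ∧ j ≤ u k ∧ u k < u i).card

/-- `n(u) = Σ_{s ∈ u} l(s)`. -/
def nstat (u : Fin n → ℕ) : ℕ := ∑ i, ∑ j ∈ Finset.range (u i), leg u i j

/-- `n'(u) = Σ_i C(u_i, 2)`. -/
def nstat' (u : Fin n → ℕ) : ℕ := ∑ i, Nat.choose (u i) 2

/-- `n(u⁺) = Σ_{i<j} min(u_i, u_j)`, the statistic `n` of the decreasing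
rearrangement of `u`. -/
def nplus (u : Fin n → ℕ) : ℕ := ∑ i, ∑ j, if i < j then min (u i) (u j) else 0

/-- `τ_u = (−1)^{|u|} q^{n'(u)} t^{−n(u⁺)}`. -/
def tau (q t : ℂ) (u : Fin n → ℕ) : ℂ := (-1) ^ wt u * q ^ nstat' u / t ^ nplus u

/-- The generalized q-shifted factorial `(z)_u = ∏_{s ∈ u} (1 − z q^{a'(s)} t^{−l'(s)})`. -/
def qfac (q t z : ℂ) (u : Fin n → ℕ) : ℂ :=
  ∏ i, ∏ j ∈ Finset.range (u i), (1 - z * q ^ j / t ^ lp u i)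

/-- `c'_u = ∏_{s ∈ u} (1 − q^{a(s)+1} t^{l(s)})`. -/
def cp (q t : ℂ) (u : Fin n → ℕ) : ℂ :=
  ∏ i, ∏ j ∈ Finset.range (u i), (1 - q ^ (u i - j) * t ^ leg u i j)

/-- `M` is a family of interpolation Macdonald polynomials: `M u` has total degree
at most `|u|`, the coefficient of `x^u` in `M u` is `q^{−n'(u)}`, and `M u`
vanishes at `⟨v⟩` for every `v` with `|v| ≤ |u|`, `v ≠ u`. -/
def IsInterpFamily (q t : ℂ) (M : (Fin n → ℕ) → MvPolynomial (Fin n) ℂ) : Prop :=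
  ∀ u, (M u).totalDegree ≤ wt u ∧
    coeff (Finsupp.equivFunOnFinite.symm u) (M u) = (q ^ nstat' u)⁻¹ ∧
    ∀ v, wt v ≤ wt u → v ≠ u → eval (spec q t v) (M u) = 0

/-- `𝖬_u = q^{n'(u)} t^{n(u)} M_u / c'_u`. -/
def MM (q t : ℂ) (M : (Fin n → ℕ) → MvPolynomial (Fin n) ℂ) (u : Fin n → ℕ) :
    MvPolynomial (Fin n) ℂ :=
  C (q ^ nstat' u * t ^ nstat u / cp q t u) * M u

/-- `𝖤_u = t^{n(u)} E_u / c'_u`, where `E_u` is the homogeneous component of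
degree `|u|` of `M_u`. -/
def EE (q t : ℂ) (M : (Fin n → ℕ) → MvPolynomial (Fin n) ℂ) (u : Fin n → ℕ) :
    MvPolynomial (Fin n) ℂ :=
  C (t ^ nstat u / cp q t u) * homogeneousComponent (wt u) (M u)

/-- The generalized q-binomial coefficient `[u; v] = 𝖬_v(⟨u⟩)/𝖬_v(⟨v⟩)`. -/
def qbin (q t : ℂ) (M : (Fin n → ℕ) → MvPolynomial (Fin n) ℂ) (u v : Fin n → ℕ) : ℂ :=
  eval (spec q t u) (MM q t M v) / eval (spec q t v) (MM q t M v)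

/-- `⟨0⟩/a = (t^{n−1}/a, …, t/a, 1/a)`. -/
def spec0div (q t a : ℂ) : Fin n → ℂ := fun i => spec q t (fun _ => 0) i / a

/-- `cc` is the family of connection coefficients `c_{uv}(a,b)`:
`cc u v = 0` unless `|v| ≤ |u|`, and `𝖬_u(a·x) = Σ_v cc u v · 𝖬_v(b·x)`. -/
def IsConnection (q t : ℂ) (M : (Fin n → ℕ) → MvPolynomial (Fin n) ℂ) (a b : ℂ)
    (cc : (Fin n → ℕ) → (Fin n → ℕ) → ℂ) : Prop :=
  (∀ u v, wt u < wt v → cc u v = 0) ∧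
  ∀ u, aeval (fun i => C a * X i) (MM q t M u) =
    ∑ᶠ v, cc u v • aeval (fun i => C b * X i) (MM q t M v)

/-- `⟦u, v⟧(a, b) = (𝖤_v(⟨0⟩/a)/𝖤_u(⟨0⟩/b)) · c_{uv}(a, b)`. -/
def skew (q t : ℂ) (M : (Fin n → ℕ) → MvPolynomial (Fin n) ℂ) (a b : ℂ)
    (cc : (Fin n → ℕ) → (Fin n → ℕ) → ℂ) (u v : Fin n → ℕ) : ℂ :=
  eval (spec0div q t a) (EE q t M v) / eval (spec0div q t b) (EE q t M u) * cc u v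

/-- `(z; q)_∞ = ∏_{m ≥ 0} (1 − z q^m)`. -/
noncomputable def qpochInf (z q : ℂ) : ℂ := ∏' m : ℕ, (1 - z * q ^ m)

/-! ### Combinatorics of the statistics on compositions -/

/-- `k` comes before `i` when the parts of `u` are sorted decreasingly, ties being broken
from left to right. -/
def Precedes (u : Fin n → ℕ) (k i : Fin n) : Prop :=
  (i < k ∧ u i < u k) ∨ (k < i ∧ u i ≤ u k)

instance (u : Fin n → ℕ) (k i : Fin n) : Decidable (Precedes u k i) := by
  unfold Precedes; infer_instance

theorem not_precedes_self (u : Fin n → ℕ) (i : Fin n) : ¬ Precedes u i i := by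
  simp [Precedes]

theorem Precedes.trans {u : Fin n → ℕ} {i j k : Fin n} (h : Precedes u i j)
    (h' : Precedes u j k) : Precedes u i k := by
  unfold Precedes at *; grind

theorem precedes_or_precedes (u : Fin n → ℕ) {i k : Fin n} (h : i ≠ k) :
    Precedes u i k ∨ Precedes u k i := by
  unfold Precedes; omega

theorem lp_eq_card (u : Fin n → ℕ) (i : Fin n) :
    lp u i = (Finset.univ.filter fun k => Precedes u k i).card := by
  unfold lp Precedes
  rw [Finset.filter_or, Finset.card_union_of_disjoint]
  rw [Finset.disjoint_filter]
  intro k _ h h'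
  omega

theorem lp_eq_sum (u : Fin n → ℕ) (i : Fin n) :
    lp u i = ∑ k, if Precedes u k i then 1 else 0 := by
  rw [lp_eq_card, Finset.card_filter]

theorem lp_lt_of_precedes {u : Fin n → ℕ} {i k : Fin n} (h : Precedes u i k) :
    lp u i < lp u k := by
  rw [lp_eq_card, lp_eq_card]
  refine Finset.card_lt_card (Finset.ssubset_iff_of_subset ?_ |>.2 ⟨i, ?_, ?_⟩)
  · intro j hj
    simp only [Finset.mem_filter_univ] at hj ⊢
    exact hj.trans h
  · simpa using h
  · simpa using not_precedes_self u i

theorem lp_lt (u : Fin n → ℕ) (i : Fin n) : lp u i < n := by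
  rw [lp_eq_card]
  conv_rhs => rw [← Fintype.card_fin n, ← Finset.card_univ]
  refine Finset.card_lt_card (Finset.filter_ssubset.2 ⟨i, Finset.mem_univ _, ?_⟩)
  exact not_precedes_self u i

theorem bijective_lp (u : Fin n → ℕ) :
    Function.Bijective fun i : Fin n => (⟨lp u i, lp_lt u i⟩ : Fin n) := by
  rw [← Finite.injective_iff_bijective]
  intro i k h
  by_contra hne
  rw [Fin.mk.injEq] at h
  rcases precedes_or_precedes u hne with h' | h' <;> have := lp_lt_of_precedes h' <;> omega

theorem sum_mul_lp (u : Fin n → ℕ) : ∑ i, u i * lp u i = nplus u := by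
  have hmin (i : Fin n) : u i * lp u i = ∑ k, if Precedes u k i then min (u i) (u k) else 0 := by
    rw [lp_eq_sum, Finset.mul_sum]
    refine Finset.sum_congr rfl fun k _ => ?_
    unfold Precedes
    grind
  have hsplit (i k : Fin n) : (if Precedes u k i then min (u i) (u k) else 0) =
      (if i < k ∧ Precedes u k i then min (u i) (u k) else 0) +
      (if k < i ∧ Precedes u k i then min (u i) (u k) else 0) := by
    unfold Precedes
    grind
  simp only [hmin, hsplit, Finset.sum_add_distrib]
  rw [Finset.sum_comm (f := fun i k => if k < i ∧ Precedes u k i then min (u i) (u k) else 0)]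
  simp only [← Finset.sum_add_distrib, nplus]
  refine Finset.sum_congr rfl fun i _ => Finset.sum_congr rfl fun k _ => ?_
  unfold Precedes
  grind

theorem lp_snoc_zero_castSucc (v : Fin n → ℕ) (i : Fin n) :
    lp (Fin.snoc v 0 : Fin (n + 1) → ℕ) i.castSucc = lp v i := by
  rw [lp_eq_sum, lp_eq_sum, Fin.sum_univ_castSucc]
  simp [Precedes, (Fin.castSucc_lt_last i).not_gt]

theorem lp_snoc_zero_last (v : Fin n → ℕ) :
    lp (Fin.snoc v 0 : Fin (n + 1) → ℕ) (Fin.last n) = n := by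
  rw [lp_eq_sum, Fin.sum_univ_castSucc]
  simp [Precedes, Fin.castSucc_lt_last]

/-- Move the first part of a composition to the end, adding one to it. -/
def shift (w : Fin (n + 1) → ℕ) : Fin (n + 1) → ℕ :=
  Fin.snoc (fun i : Fin n => w i.succ) (w 0 + 1)

theorem lp_shift_castSucc (w : Fin (n + 1) → ℕ) (i : Fin n) :
    lp (shift w) i.castSucc = lp w i.succ := by
  rw [lp_eq_sum, lp_eq_sum, Fin.sum_univ_castSucc, Fin.sum_univ_succ, add_comm]
  simp [shift, Precedes, (Fin.castSucc_lt_last i).not_gt, Fin.castSucc_lt_last]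

theorem lp_shift_last (w : Fin (n + 1) → ℕ) : lp (shift w) (Fin.last n) = lp w 0 := by
  rw [lp_eq_sum, lp_eq_sum, Fin.sum_univ_castSucc, Fin.sum_univ_succ, add_comm]
  simp [shift, Precedes, Fin.castSucc_lt_last, (Fin.castSucc_lt_last _).not_gt]

theorem wt_snoc (v : Fin n → ℕ) (m : ℕ) : wt (Fin.snoc v m : Fin (n + 1) → ℕ) = wt v + m := by
  simp [wt, Fin.sum_univ_castSucc]

theorem wt_shift (w : Fin (n + 1) → ℕ) : wt (shift w) = wt w + 1 := by
  rw [shift, wt_snoc, wt, wt, Fin.sum_univ_succ]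
  ring

/-! ### Spectral vectors -/

theorem spec_snoc_zero (q t : ℂ) (v : Fin n → ℕ) :
    spec q t (Fin.snoc v 0 : Fin (n + 1) → ℕ) = Fin.snoc (fun i => t * spec q t v i) 1 := by
  funext i
  refine Fin.lastCases ?_ (fun i => ?_) i
  · simp [spec, lp_snoc_zero_last]
  · have h : n + 1 - 1 - lp v i = (n - 1 - lp v i) + 1 := by have := lp_lt v i; omega
    simp only [spec, lp_snoc_zero_castSucc, Fin.snoc_castSucc, h]
    ring

theorem spec_shift (q t : ℂ) (w : Fin (n + 1) → ℕ) :
    spec q t (shift w) = Fin.snoc (fun i : Fin n => spec q t w i.succ) (q * spec q t w 0) := by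
  funext i
  refine Fin.lastCases ?_ (fun i => ?_) i
  · simp only [spec, lp_shift_last, Fin.snoc_last]
    simp only [shift, Fin.snoc_last]
    ring
  · simp only [spec, lp_shift_castSucc, Fin.snoc_castSucc]
    simp [shift]

/-! ### Interpolation on the spectral vectors -/

theorem totalDegree_aeval_le {σ τ : Type*} {g : σ → MvPolynomial τ ℂ}
    (hg : ∀ i, (g i).totalDegree ≤ 1) (f : MvPolynomial σ ℂ) :
    (aeval g f).totalDegree ≤ f.totalDegree := by
  rw [aeval_def, eval₂_eq]
  refine totalDegree_finsetSum_le fun d hd => ?_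
  refine (totalDegree_mul _ _).trans ?_
  rw [algebraMap_eq, totalDegree_C, zero_add]
  refine (totalDegree_finsetProd _ _).trans (le_trans ?_ (le_totalDegree hd))
  rw [Finsupp.sum]
  refine Finset.sum_le_sum fun i _ => (totalDegree_pow _ _).trans ?_
  exact (Nat.mul_le_mul_left _ (hg i)).trans (mul_one _).le

theorem eval_aeval {σ τ : Type*} (x : τ → ℂ) (g : σ → MvPolynomial τ ℂ) (f : MvPolynomial σ ℂ) :
    eval x (aeval g f) = eval (fun i => eval x (g i)) f := by
  rw [aeval_def, eval₂_eq, map_sum, eval_eq]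
  simp

theorem dvd_of_aeval_snoc_eq_zero {t : ℂ} (ht : t ≠ 0) {f : MvPolynomial (Fin (n + 1)) ℂ}
    (hf : aeval (Fin.snoc (fun i : Fin n => C t * X i) 1 :
      Fin (n + 1) → MvPolynomial (Fin n) ℂ) f = 0) :
    (X (Fin.last n) - 1 : MvPolynomial (Fin (n + 1)) ℂ) ∣ f := by
  set I := Ideal.span {(X (Fin.last n) - 1 : MvPolynomial (Fin (n + 1)) ℂ)} with hI
  have hcomp : ((Ideal.Quotient.mkₐ ℂ I).comp (aeval fun i : Fin n => C t⁻¹ * X i.castSucc)).comp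
      (aeval (Fin.snoc (fun i : Fin n => C t * X i) 1 :
        Fin (n + 1) → MvPolynomial (Fin n) ℂ)) = Ideal.Quotient.mkₐ ℂ I := by
    refine algHom_ext fun i => ?_
    refine Fin.lastCases ?_ (fun i => ?_) i
    · have : Ideal.Quotient.mk I (1 - X (Fin.last n)) = 0 := by
        rw [Ideal.Quotient.eq_zero_iff_mem, hI, Ideal.mem_span_singleton]
        exact ⟨-1, by ring⟩
      simpa [sub_eq_zero] using this
    · have : (C t * (C t⁻¹ * X i.castSucc) : MvPolynomial (Fin (n + 1)) ℂ) = X i.castSucc := by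
        rw [← mul_assoc, ← C_mul, mul_inv_cancel₀ ht, C_1, one_mul]
      simp only [AlgHom.comp_apply, aeval_X, Fin.snoc_castSucc, map_mul (aeval _), algHom_C,
        algebraMap_eq, this]
  have := DFunLike.congr_fun hcomp f
  rw [AlgHom.comp_apply, hf, map_zero] at this
  rw [← Ideal.mem_span_singleton, ← hI, ← Ideal.Quotient.eq_zero_iff_mem]
  exact this.symm

theorem eq_zero_of_aeval_snoc_eq_zero {q : ℂ} (hq : q ≠ 0) {f : MvPolynomial (Fin (n + 1)) ℂ}
    (hf : aeval (Fin.snoc (fun i : Fin n => X i.succ) (C q * X 0) :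
      Fin (n + 1) → MvPolynomial (Fin (n + 1)) ℂ) f = 0) : f = 0 := by
  have hcomp : (aeval (Fin.cons (C q⁻¹ * X (Fin.last n)) (fun i : Fin n => X i.castSucc) :
      Fin (n + 1) → MvPolynomial (Fin (n + 1)) ℂ)).comp
      (aeval (Fin.snoc (fun i : Fin n => X i.succ) (C q * X 0) :
        Fin (n + 1) → MvPolynomial (Fin (n + 1)) ℂ)) = AlgHom.id ℂ _ := by
    refine algHom_ext fun i => ?_
    refine Fin.lastCases ?_ (fun i => ?_) i
    · have : (C q * (C q⁻¹ * X (Fin.last n)) : MvPolynomial (Fin (n + 1)) ℂ) = X (Fin.last n) := by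
        rw [← mul_assoc, ← C_mul, mul_inv_cancel₀ hq, C_1, one_mul]
      simp only [AlgHom.comp_apply, aeval_X, Fin.snoc_last, map_mul, algHom_C, algebraMap_eq,
        Fin.cons_zero, this, AlgHom.id_apply]
    · simp
  have := DFunLike.congr_fun hcomp f
  rwa [AlgHom.comp_apply, hf, map_zero, AlgHom.id_apply, eq_comm] at this

theorem eq_zero_of_eval_spec_eq_zero {q t : ℂ} (hq0 : q ≠ 0) (ht : t ≠ 0)
    (hqt : ∀ i j : ℤ, ¬(i = 0 ∧ j = 0) → q ^ i * t ^ j ≠ 1) :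
    ∀ {n : ℕ} (k : ℕ) (f : MvPolynomial (Fin n) ℂ), f.totalDegree ≤ k →
      (∀ v, wt v ≤ k → eval (spec q t v) f = 0) → f = 0
  | 0, k, f, _, hv => by
    have h := hv 0 (by simp [wt])
    rw [eq_C_of_isEmpty f, eval_C] at h
    rw [eq_C_of_isEmpty f, h, C_0]
  | n + 1, k, f, hd, hv => by
    have hrestrict : aeval (Fin.snoc (fun i : Fin n => C t * X i) 1 :
        Fin (n + 1) → MvPolynomial (Fin n) ℂ) f = 0 := by
      refine eq_zero_of_eval_spec_eq_zero hq0 ht hqt k _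
        ((totalDegree_aeval_le (fun i => ?_) f).trans hd) fun v hvk => ?_
      · refine Fin.lastCases ?_ (fun i => ?_) i
        · simp
        · rw [Fin.snoc_castSucc]
          refine (totalDegree_mul _ _).trans ?_
          simp
      · have h := hv (Fin.snoc v 0) (by rwa [wt_snoc])
        rw [spec_snoc_zero] at h
        rw [eval_aeval, ← h]
        congr 2
        funext i
        refine Fin.lastCases ?_ (fun i => ?_) i <;> simp
    obtain ⟨g, rfl⟩ := dvd_of_aeval_snoc_eq_zero ht hrestrict
    by_contra hne
    obtain ⟨hX, hg⟩ := mul_ne_zero_iff.1 hne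
    have hXdeg : (X (Fin.last n) - 1 : MvPolynomial (Fin (n + 1)) ℂ).totalDegree = 1 := by
      rw [sub_eq_add_neg, totalDegree_add_eq_left_of_totalDegree_lt] <;> simp
    rw [totalDegree_mul_of_isDomain hX hg, hXdeg] at hd
    obtain ⟨k, rfl⟩ : ∃ m, k = m + 1 := ⟨k - 1, by omega⟩
    refine hg (eq_zero_of_aeval_snoc_eq_zero hq0 ?_)
    refine eq_zero_of_eval_spec_eq_zero hq0 ht hqt k _
      ((totalDegree_aeval_le (fun i => ?_) g).trans (by omega)) fun w hw => ?_
    · refine Fin.lastCases ?_ (fun i => ?_) i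
      · rw [Fin.snoc_last]
        refine (totalDegree_mul _ _).trans ?_
        simp
      · simp
    · have h := hv (shift w) (by rw [wt_shift]; omega)
      rw [map_mul, mul_eq_zero] at h
      have hspec : (fun i => eval (spec q t w) ((Fin.snoc (fun i : Fin n => X i.succ) (C q * X 0) :
          Fin (n + 1) → MvPolynomial (Fin (n + 1)) ℂ) i)) = spec q t (shift w) := by
        rw [spec_shift]
        funext i
        refine Fin.lastCases ?_ (fun i => ?_) i <;> simp
      rw [eval_aeval, hspec]
      refine h.resolve_left fun h => ?_
      have h1 := hqt (shift w (Fin.last n)) (n + 1 - 1 - lp (shift w) (Fin.last n) : ℕ) (by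
        simp [shift]; omega)
      rw [zpow_natCast, zpow_natCast] at h1
      rw [map_sub, eval_X, map_one, sub_eq_zero] at h
      exact h1 h
termination_by n k => (n, k)

/-! ### The q-exponential series -/

/-- The series `∑ Xᵐ / ((1 - q) ⋯ (1 - qᵐ))`. -/
def qexp (q : ℂ) : PowerSeries ℂ :=
  PowerSeries.mk fun m => (∏ j ∈ Finset.range m, (1 - q ^ (j + 1)))⁻¹

theorem rescale_qexp {q : ℂ} (hq : ∀ j : ℕ, q ^ (j + 1) ≠ 1) :
    PowerSeries.rescale q (qexp q) = (1 - PowerSeries.X) * qexp q := by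
  ext m
  cases m with
  | zero => simp [qexp, sub_mul]
  | succ m =>
    have h : ∏ j ∈ Finset.range m, (1 - q ^ (j + 1)) ≠ 0 :=
      Finset.prod_ne_zero_iff.2 fun j _ => sub_ne_zero.2 (hq j).symm
    have h' : 1 - q ^ (m + 1) ≠ 0 := sub_ne_zero.2 (hq m).symm
    rw [sub_mul, one_mul, map_sub, PowerSeries.coeff_succ_X_mul]
    simp only [qexp, PowerSeries.coeff_rescale, PowerSeries.coeff_mk, Finset.prod_range_succ]
    field_simp
    ring

theorem rescale_mul_pow_qexp {q : ℂ} (hq : ∀ j : ℕ, q ^ (j + 1) ≠ 1) (c : ℂ) (N : ℕ) :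
    PowerSeries.rescale (c * q ^ N) (qexp q) =
      (∏ j ∈ Finset.range N, (1 - PowerSeries.C (c * q ^ j) * PowerSeries.X)) *
        PowerSeries.rescale c (qexp q) := by
  induction N with
  | zero => simp
  | succ N ih =>
    rw [pow_succ, ← mul_assoc, mul_comm (c * q ^ N) q, PowerSeries.rescale_mul, RingHom.comp_apply,
      rescale_qexp hq, map_mul, ih, Finset.prod_range_succ, map_sub, map_one,
      PowerSeries.rescale_X]
    ring

theorem qexp_inv_mul_qexp (q : ℂ) : (qexp q)⁻¹ * qexp q = 1 :=
  PowerSeries.inv_mul_cancel _ (by simp [qexp])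

/-! ### The q-shifted factorial as a function of the spectral vector -/

/-- The q-shifted factorial `(z)_u` as a polynomial in `z`. -/
def qfacPoly (q t : ℂ) (u : Fin n → ℕ) : Polynomial ℂ :=
  ∏ i, ∏ j ∈ Finset.range (u i), (1 - Polynomial.C ((t ^ lp u i)⁻¹ * q ^ j) * Polynomial.X)

theorem eval_qfacPoly (q t a : ℂ) (u : Fin n → ℕ) : (qfacPoly q t u).eval a = qfac q t a u := by
  simp only [qfacPoly, qfac, Polynomial.eval_prod]
  refine Finset.prod_congr rfl fun i _ => Finset.prod_congr rfl fun j _ => ?_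
  simp
  ring

theorem natDegree_one_sub_C_mul_X_le (c : ℂ) :
    (1 - Polynomial.C c * Polynomial.X).natDegree ≤ 1 := by
  compute_degree

theorem natDegree_qfacPoly_le (q t : ℂ) (u : Fin n → ℕ) : (qfacPoly q t u).natDegree ≤ wt u := by
  rw [qfacPoly, Finset.prod_sigma']
  refine (Polynomial.natDegree_prod_le _ _).trans ?_
  refine (Finset.sum_le_card_nsmul _ _ 1 fun x _ => natDegree_one_sub_C_mul_X_le _).trans ?_
  simp [wt]

theorem coeff_qfacPoly_wt (q t : ℂ) (u : Fin n → ℕ) :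
    (qfacPoly q t u).coeff (wt u) = tau q t u := by
  have hcard : wt u = (Finset.univ.sigma fun i => Finset.range (u i)).card * 1 := by simp [wt]
  rw [qfacPoly, Finset.prod_sigma', hcard, Polynomial.coeff_prod_of_natDegree_le _ _ _
    fun x _ => natDegree_one_sub_C_mul_X_le _, Finset.prod_sigma]
  have hcoeff (c : ℂ) : (1 - Polynomial.C c * Polynomial.X).coeff 1 = -1 * c := by
    simp [Polynomial.coeff_one]
  have hrange (m : ℕ) : ∏ j ∈ Finset.range m, q ^ j = q ^ m.choose 2 := by
    rw [Finset.prod_pow_eq_pow_sum _ (fun j => j), Finset.sum_range_id, Nat.choose_two_right]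
  simp only [hcoeff, hrange, Finset.prod_mul_distrib, Finset.prod_const, Finset.card_range,
    Finset.prod_pow_eq_pow_sum, inv_pow, Finset.prod_inv_distrib, ← pow_mul]
  have hlp : ∑ i, lp u i * u i = nplus u := by simp only [← sum_mul_lp, mul_comm]
  rw [hlp, tau, nstat', wt]
  ring

/-- The generating series whose coefficients interpolate those of the q-shifted factorials. -/
def genSeries (q t : ℂ) (n : ℕ) : PowerSeries (MvPolynomial (Fin n) ℂ) :=
  (∏ i : Fin n, PowerSeries.map C (PowerSeries.rescale (t ^ (i : ℕ))⁻¹ (qexp q)⁻¹)) *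
    ∏ i : Fin n, PowerSeries.rescale (C (t ^ (n - 1))⁻¹ * X i) (PowerSeries.map C (qexp q))

theorem map_eval_genSeries {q t : ℂ} (ht : t ≠ 0) (hq : ∀ j : ℕ, q ^ (j + 1) ≠ 1)
    (u : Fin n → ℕ) :
    PowerSeries.map (eval (spec q t u)) (genSeries q t n) = (qfacPoly q t u : PowerSeries ℂ) := by
  have hnum (f : PowerSeries ℂ) : PowerSeries.map (eval (spec q t u)) (PowerSeries.map C f) = f := by
    ext; simp
  have hspec (i : Fin n) : (t ^ (n - 1))⁻¹ * spec q t u i = (t ^ lp u i)⁻¹ * q ^ u i := by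
    have h : n - 1 = (n - 1 - lp u i) + lp u i := by have := lp_lt u i; omega
    rw [spec]
    conv_lhs => rw [h, pow_add]
    simp only [Nat.add_sub_cancel]
    field_simp
  have hden (i : Fin n) : PowerSeries.map (eval (spec q t u))
      (PowerSeries.rescale (C (t ^ (n - 1))⁻¹ * X i) (PowerSeries.map C (qexp q))) =
      PowerSeries.rescale ((t ^ lp u i)⁻¹ * q ^ u i) (qexp q) := by
    rw [← hspec]
    ext m
    simp
  rw [genSeries, map_mul, map_prod, map_prod]
  simp only [hnum, hden]
  rw [← (bijective_lp u).prod_comp fun i : Fin n =>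
    PowerSeries.rescale (t ^ (i : ℕ))⁻¹ (qexp q)⁻¹, ← Finset.prod_mul_distrib, qfacPoly,
    ← Polynomial.coeToPowerSeries.ringHom_apply, map_prod]
  refine Finset.prod_congr rfl fun i _ => ?_
  rw [rescale_mul_pow_qexp hq, mul_left_comm, ← map_mul, qexp_inv_mul_qexp, map_one, mul_one,
    map_prod]
  simp

/-- The `k`-th coefficient has total degree at most `k`. -/
def DegreeBounded {σ : Type*} (F : PowerSeries (MvPolynomial σ ℂ)) : Prop :=
  ∀ k, (PowerSeries.coeff k F).totalDegree ≤ k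

theorem DegreeBounded.mul {σ : Type*} {F G : PowerSeries (MvPolynomial σ ℂ)}
    (hF : DegreeBounded F) (hG : DegreeBounded G) : DegreeBounded (F * G) := by
  intro k
  rw [PowerSeries.coeff_mul]
  refine totalDegree_finsetSum_le fun p hp => (totalDegree_mul _ _).trans ?_
  exact (add_le_add (hF _) (hG _)).trans (Finset.HasAntidiagonal.mem_antidiagonal.1 hp).le

theorem DegreeBounded.prod {σ ι : Type*} {s : Finset ι} {F : ι → PowerSeries (MvPolynomial σ ℂ)}
    (hF : ∀ i ∈ s, DegreeBounded (F i)) : DegreeBounded (∏ i ∈ s, F i) := by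
  refine Finset.prod_induction _ _ (fun _ _ => DegreeBounded.mul) (fun k => ?_) hF
  rw [PowerSeries.coeff_one]
  split_ifs <;> simp

theorem degreeBounded_genSeries (q t : ℂ) (n : ℕ) : DegreeBounded (genSeries q t n) := by
  refine .mul (.prod fun i _ k => ?_) (.prod fun i _ k => ?_)
  · rw [PowerSeries.coeff_map, totalDegree_C]
    exact Nat.zero_le k
  · rw [PowerSeries.coeff_rescale, PowerSeries.coeff_map]
    refine (totalDegree_mul _ _).trans ?_
    rw [totalDegree_C, add_zero]
    refine (totalDegree_pow _ _).trans ((Nat.mul_le_mul_left _ ?_).trans (mul_one k).le)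
    refine (totalDegree_mul _ _).trans ?_
    simp

/-! ### Interpolation Macdonald polynomials -/

theorem IsInterpFamily.eval_self_ne_zero {q t : ℂ} (hq0 : q ≠ 0) (ht : t ≠ 0)
    (hqt : ∀ i j : ℤ, ¬(i = 0 ∧ j = 0) → q ^ i * t ^ j ≠ 1)
    {M : (Fin n → ℕ) → MvPolynomial (Fin n) ℂ} (hM : IsInterpFamily q t M) (v : Fin n → ℕ) :
    eval (spec q t v) (M v) ≠ 0 := by
  intro h
  obtain ⟨hdeg, hcoeff, hvan⟩ := hM v
  have hzero : M v = 0 := by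
    refine eq_zero_of_eval_spec_eq_zero hq0 ht hqt _ _ hdeg fun w hw => ?_
    obtain rfl | hne := eq_or_ne w v
    · exact h
    · exact hvan w hw hne
  rw [hzero, coeff_zero] at hcoeff
  exact inv_ne_zero (pow_ne_zero _ hq0) hcoeff.symm

theorem qbin_eq {q t : ℂ} (hq0 : q ≠ 0) (ht : t ≠ 0)
    (hqt : ∀ i j : ℤ, ¬(i = 0 ∧ j = 0) → q ^ i * t ^ j ≠ 1)
    (M : (Fin n → ℕ) → MvPolynomial (Fin n) ℂ) (u v : Fin n → ℕ) :
    qbin q t M u v = eval (spec q t u) (M v) / eval (spec q t v) (M v) := by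
  have hcp : cp q t v ≠ 0 := by
    refine Finset.prod_ne_zero_iff.2 fun i _ => Finset.prod_ne_zero_iff.2 fun j hj => ?_
    have hj := Finset.mem_range.1 hj
    have h := hqt (v i - j : ℕ) (leg v i j) (by omega)
    rw [zpow_natCast, zpow_natCast] at h
    exact sub_ne_zero.2 h.symm
  simp only [qbin, MM]
  rw [map_mul, map_mul, eval_C, eval_C, mul_div_mul_left]
  exact div_ne_zero (mul_ne_zero (pow_ne_zero _ hq0) (pow_ne_zero _ ht)) hcp

theorem mem_piAntidiag_univ {k : ℕ} {v : Fin n → ℕ} :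
    v ∈ Finset.piAntidiag Finset.univ k ↔ wt v = k := by
  simp [wt]

theorem coeff_genSeries {q t : ℂ} (hq0 : q ≠ 0) (ht : t ≠ 0)
    (hqt : ∀ i j : ℤ, ¬(i = 0 ∧ j = 0) → q ^ i * t ^ j ≠ 1)
    {M : (Fin n → ℕ) → MvPolynomial (Fin n) ℂ} (hM : IsInterpFamily q t M) (k : ℕ) :
    PowerSeries.coeff k (genSeries q t n) =
      ∑ v ∈ Finset.piAntidiag Finset.univ k, C (tau q t v / eval (spec q t v) (M v)) * M v := by
  rw [← sub_eq_zero]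
  refine eq_zero_of_eval_spec_eq_zero hq0 ht hqt k _ ?_ fun w hw => ?_
  · refine (totalDegree_sub _ _).trans (max_le (degreeBounded_genSeries q t n k) ?_)
    refine totalDegree_finsetSum_le fun v hv => (totalDegree_mul _ _).trans ?_
    rw [totalDegree_C, zero_add, ← mem_piAntidiag_univ.1 hv]
    exact (hM v).1
  · have hq (j : ℕ) : q ^ (j + 1) ≠ 1 := by
      have h := hqt (j + 1 : ℕ) 0 (by omega)
      rwa [zpow_natCast, zpow_zero, mul_one] at h
    have hvan {v : Fin n → ℕ} (hv : v ∈ Finset.piAntidiag Finset.univ k) (hne : v ≠ w) :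
        eval (spec q t w) (C (tau q t v / eval (spec q t v) (M v)) * M v) = 0 := by
      rw [map_mul, (hM v).2.2 w (hw.trans_eq (mem_piAntidiag_univ.1 hv).symm) hne.symm, mul_zero]
    have hgen : eval (spec q t w) (PowerSeries.coeff k (genSeries q t n)) =
        (qfacPoly q t w).coeff k := by
      rw [← PowerSeries.coeff_map, map_eval_genSeries ht hq, Polynomial.coeff_coe]
    rw [map_sub, map_sum, hgen, sub_eq_zero]
    obtain hlt | rfl := hw.lt_or_eq
    · rw [Polynomial.coeff_eq_zero_of_natDegree_lt ((natDegree_qfacPoly_le q t w).trans_lt hlt)]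
      refine (Finset.sum_eq_zero fun v hv => hvan hv ?_).symm
      rintro rfl
      exact hlt.ne (mem_piAntidiag_univ.1 hv)
    · rw [coeff_qfacPoly_wt, Finset.sum_eq_single_of_mem w (mem_piAntidiag_univ.2 rfl)
        fun v hv hne => hvan hv hne, map_mul, eval_C,
        div_mul_cancel₀ _ (hM.eval_self_ne_zero hq0 ht hqt w)]

/-- **Expansion of the generalized q-shifted factorial** (Corollary 5.3). -/
theorem qfac_expansion
    (hn : 0 < n) (q t : ℂ) (hq0 : q ≠ 0) (ht : t ≠ 0)
    (hqt : ∀ i j : ℤ, ¬(i = 0 ∧ j = 0) → q ^ i * t ^ j ≠ 1)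
    (M : (Fin n → ℕ) → MvPolynomial (Fin n) ℂ) (hM : IsInterpFamily q t M)
    (u : Fin n → ℕ) (a : ℂ) :
    qfac q t a u = ∑ᶠ v : Fin n → ℕ, tau q t v * a ^ wt v * qbin q t M u v := by
  have hq (j : ℕ) : q ^ (j + 1) ≠ 1 := by
    have h := hqt (j + 1 : ℕ) 0 (by omega)
    rwa [zpow_natCast, zpow_zero, mul_one] at h
  have hcoeff (k : ℕ) : (qfacPoly q t u).coeff k =
      ∑ v ∈ Finset.piAntidiag Finset.univ k, tau q t v * qbin q t M u v := by
    rw [← Polynomial.coeff_coe, ← map_eval_genSeries ht hq, PowerSeries.coeff_map,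
      coeff_genSeries hq0 ht hqt hM, map_sum]
    refine Finset.sum_congr rfl fun v _ => ?_
    rw [map_mul, eval_C, qbin_eq hq0 ht hqt]
    ring
  have hsupp : (Function.support fun v : Fin n → ℕ => tau q t v * a ^ wt v * qbin q t M u v) ⊆
      ((Finset.range (wt u + 1)).biUnion fun k => Finset.piAntidiag Finset.univ k :
        Finset (Fin n → ℕ)) := by
    intro v hv
    simp only [Finset.mem_coe, Finset.mem_biUnion, mem_piAntidiag_univ, Finset.mem_range]
    by_contra! hlt
    have hwt : wt u < wt v := not_le.1 fun h => hlt _ (Nat.lt_succ_of_le h) rfl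
    refine hv ?_
    beta_reduce
    rw [qbin_eq hq0 ht hqt, (hM v).2.2 u hwt.le (fun h => hwt.ne (congrArg wt h)), zero_div,
      mul_zero]
  rw [← eval_qfacPoly, finsum_eq_sum_of_support_subset _ hsupp, Finset.sum_biUnion,
    Polynomial.eval_eq_sum_range' (Nat.lt_succ_of_le (natDegree_qfacPoly_le q t u))]
  · refine Finset.sum_congr rfl fun k _ => ?_
    rw [hcoeff, Finset.sum_mul]
    refine Finset.sum_congr rfl fun v hv => ?_
    rw [mem_piAntidiag_univ.1 hv]
    ring
  · intro k _ l _ hkl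
    refine Finset.disjoint_left.2 fun v hv hv' => hkl ?_
    rw [← mem_piAntidiag_univ.1 hv, ← mem_piAntidiag_univ.1 hv']

end LRW
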